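/- Let μ be a Borel probability measure on ℝ with ∫ x dμ(x) = 0 and 0 < D := ∫ x² dμ(x) < ∞, and let χ_μ be its characteristic function. Then for every u ∈ Ĥ and every T > 0, sup_{t ∈ [0,T]} ‖(x ↦ χ_μ(√(t/n)·x)ⁿ · u(x)) − (x ↦ e^{−tDx²/2} · u(x))‖_{Ĥ} → 0 as n → ∞. That is, the mean values of the quantum random walks E Û_n(t), which act as multiplication by χ_μ(√(t/n)·x)ⁿ, converge in the strong operator topology, uniformly in t on every segment of [0, ∞), to the semigroup of operators of multiplication by e^{−tDx²/2}. -/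

import Mathlib

open MeasureTheory Complex Filter
open scoped ComplexConjugate ENNReal Classical

noncomputable section

/-- `Ĥ = L²(ℝ, ν; ℂ)`: the Hilbert space of complex-valued functions on `ℝ` that are
square-summable with respect to the counting measure, realized as `lp (fun _ : ℝ => ℂ) 2`
(functions with countable support and square-summable values), with inner product
`⟪u, v⟫ = ∑' x, conj (u x) * v x`, conjugate-linear in the first argument. -/
abbrev Hhat : Type := lp (fun _ : ℝ => ℂ) 2

lemma memℓp_shift (h : ℝ) (u : Hhat) : Memℓp (fun x : ℝ => u (x + h)) 2 := by
  refine memℓp_gen ?_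
  have hs : Summable fun x : ℝ => ‖u x‖ ^ (2 : ℝ≥0∞).toReal :=
    (lp.memℓp u).summable (by norm_num)
  exact ((Equiv.addRight h).summable_iff
    (f := fun x : ℝ => ‖u x‖ ^ (2 : ℝ≥0∞).toReal)).mpr hs

/-- The shift operator `Ŝ_h` on `Ĥ`, `(Ŝ_h u) x = u (x + h)`. -/
def Shat (h : ℝ) (u : Hhat) : Hhat := ⟨fun x : ℝ => u (x + h), memℓp_shift h u⟩

lemma memℓp_mul_of_le {g : ℝ → ℂ} {C : ℝ} (hg : ∀ x, ‖g x‖ ≤ C) (u : Hhat) :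
    Memℓp (fun x : ℝ => g x * u x) 2 := by
  refine memℓp_gen ?_
  have hs : Summable fun x : ℝ => ‖u x‖ ^ (2 : ℝ≥0∞).toReal :=
    (lp.memℓp u).summable (by norm_num)
  have h2 : (2 : ℝ≥0∞).toReal = (2 : ℝ) := by norm_num
  rw [h2] at hs ⊢
  refine Summable.of_nonneg_of_le (fun x => by positivity) (fun x => ?_) (hs.mul_left (C ^ 2))
  calc ‖g x * u x‖ ^ (2 : ℝ) = ‖g x‖ ^ (2 : ℝ) * ‖u x‖ ^ (2 : ℝ) := by
        rw [norm_mul, Real.mul_rpow (norm_nonneg _) (norm_nonneg _)]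
    _ ≤ C ^ (2 : ℝ) * ‖u x‖ ^ (2 : ℝ) := by gcongr; exact hg x
    _ = C ^ 2 * ‖u x‖ ^ (2 : ℝ) := by rw [Real.rpow_two]

/-- The modulation operator `M̂_a` on `Ĥ`, `(M̂_a u) x = e^{iax} u x`. -/
def Mhat (a : ℝ) (u : Hhat) : Hhat :=
  ⟨fun x : ℝ => Complex.exp ((a * x : ℝ) * Complex.I) * u x,
    memℓp_mul_of_le (C := 1) (fun x => le_of_eq (Complex.norm_exp_ofReal_mul_I _)) u⟩

/-- Multiplication `M_f u` of an element of `Ĥ` by a function `f : ℝ → ℂ`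
(with junk value `0` in case the product fails to be square-summable; for bounded `f`
the `dite` always takes the first branch). -/
def mulElem (f : ℝ → ℂ) (u : Hhat) : Hhat :=
  if h : Memℓp (fun x : ℝ => f x * u x) 2 then ⟨_, h⟩ else 0

lemma mulElem_apply {f : ℝ → ℂ} {C : ℝ} (hf : ∀ x, ‖f x‖ ≤ C) (u : Hhat) (x : ℝ) :
    mulElem f u x = f x * u x := by
  rw [mulElem, dif_pos (memℓp_mul_of_le hf u)]

/-- Dominated convergence for multiplication operators on `Ĥ`, along an arbitrary filter. -/
lemma tendsto_norm_mulElem_sub {ι : Type*} {F : Filter ι} {f g : ι → ℝ → ℂ} {C : ℝ}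
    (hf : ∀ᶠ i in F, ∀ x, ‖f i x‖ ≤ C) (hg : ∀ᶠ i in F, ∀ x, ‖g i x‖ ≤ C)
    (hfg : ∀ x, Tendsto (fun i => f i x - g i x) F (nhds 0)) (u : Hhat) :
    Tendsto (fun i => ‖mulElem (f i) u - mulElem (g i) u‖) F (nhds 0) := by
  have hu : Summable fun x : ℝ => ‖u x‖ ^ 2 := by
    simpa using (lp.memℓp u).summable (by norm_num)
  have hlim : Tendsto (fun i => ∑' x, ‖(f i x - g i x) * u x‖ ^ 2) F (nhds 0) := by
    rw [← tsum_zero (α := ℝ) (β := ℝ)]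
    refine tendsto_tsum_of_dominated_convergence (hu.mul_left ((2 * C) ^ 2)) (fun _ => ?_) ?_
    · simpa using (((hfg _).mul_const (u _)).norm).pow 2
    · filter_upwards [hf, hg] with i hfi hgi x
      rw [norm_pow, norm_norm, norm_mul, mul_pow]
      gcongr
      linarith [norm_sub_le (f i x) (g i x), hfi x, hgi x]
  have hsq : Tendsto (fun i => ‖mulElem (f i) u - mulElem (g i) u‖ ^ 2) F (nhds 0) := by
    refine hlim.congr' ?_
    filter_upwards [hf, hg] with i hfi hgi
    have h := lp.norm_rpow_eq_tsum (p := 2) (by norm_num) (mulElem (f i) u - mulElem (g i) u)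
    simp only [ENNReal.toReal_ofNat, Real.rpow_two] at h
    rw [h]
    refine tsum_congr fun x => ?_
    rw [lp.coeFn_sub, Pi.sub_apply, mulElem_apply hfi, mulElem_apply hgi, sub_mul]
  simpa [Real.sqrt_sq] using hsq.sqrt

lemma norm_pow_sub_pow_le_of_norm_le_one {R : Type*} [NormedCommRing R] [NormOneClass R] {a b : R}
    (ha : ‖a‖ ≤ 1) (hb : ‖b‖ ≤ 1) (n : ℕ) : ‖a ^ n - b ^ n‖ ≤ n * ‖a - b‖ := by
  induction n with
  | zero => simp
  | succ n ih =>
    have hbn : ‖b ^ n‖ ≤ 1 := (norm_pow_le b n).trans (pow_le_one₀ (norm_nonneg b) hb)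
    calc ‖a ^ (n + 1) - b ^ (n + 1)‖ = ‖a * (a ^ n - b ^ n) + (a - b) * b ^ n‖ := by ring_nf
      _ ≤ ‖a‖ * ‖a ^ n - b ^ n‖ + ‖a - b‖ * ‖b ^ n‖ :=
        (norm_add_le _ _).trans (add_le_add (norm_mul_le _ _) (norm_mul_le _ _))
      _ ≤ 1 * (n * ‖a - b‖) + ‖a - b‖ * 1 := by gcongr
      _ = (n + 1 : ℕ) * ‖a - b‖ := by push_cast; ring

/-- A centered law with finite second moment has the characteristic function of the Gaussian law
of the same variance, up to second order at `0`. -/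
lemma charFun_sub_exp_isLittleO {μ : Measure ℝ} [IsProbabilityMeasure μ]
    (hmom : Integrable (fun x : ℝ => x ^ 2) μ) (hmean : (∫ x, x ∂μ) = 0) :
    (fun s : ℝ => charFun μ s - (Real.exp (-((∫ x, x ^ 2 ∂μ) * s ^ 2 / 2)) : ℝ))
      =o[nhds 0] fun s : ℝ => s ^ 2 := by
  set D := ∫ x, x ^ 2 ∂μ with hD
  have hL : MemLp id 2 μ := (memLp_two_iff_integrable_sq (by fun_prop)).2 hmom
  have hchar : (fun s : ℝ => charFun μ s - (1 - D * s ^ 2 / 2 : ℝ))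
      =o[nhds 0] fun s : ℝ => s ^ 2 := by
    have h := taylor_isLittleO_univ (x₀ := 0) (contDiff_charFun (n := 2) hL)
    simp only [sub_zero] at h
    refine h.congr_left fun s => ?_
    rw [taylorWithinEval_charFun_zero (n := 2) hL]
    simp only [Finset.sum_range_succ, Finset.range_zero, Finset.sum_empty, pow_one, hmean, ← hD]
    simp [mul_pow]
    ring
  have hexp : (fun s : ℝ => Real.exp (-(D * s ^ 2 / 2)) - (1 - D * s ^ 2 / 2))
      =o[nhds 0] fun s : ℝ => s ^ 2 := by
    have hderiv := (hasDerivAt_iff_isLittleO_nhds_zero.1 (Real.hasDerivAt_exp 0))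
    have hlim : Tendsto (fun s : ℝ => -(D * s ^ 2 / 2)) (nhds 0) (nhds 0) := by
      have : Continuous fun s : ℝ => -(D * s ^ 2 / 2) := by fun_prop
      simpa using this.tendsto 0
    have hO : (fun s : ℝ => -(D * s ^ 2 / 2)) =O[nhds 0] fun s : ℝ => s ^ 2 :=
      ((Asymptotics.isBigO_refl _ _).const_mul_left (-(D / 2))).congr_left fun s => by ring
    refine ((hderiv.comp_tendsto hlim).trans_isBigO hO).congr_left fun s => ?_
    simp
    ring
  have hexp' : (fun s : ℝ => ((Real.exp (-(D * s ^ 2 / 2)) - (1 - D * s ^ 2 / 2) : ℝ) : ℂ))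
      =o[nhds 0] fun s : ℝ => s ^ 2 :=
    Asymptotics.IsLittleO.of_norm_left (by simpa only [Complex.norm_real] using hexp.norm_left)
  refine (hchar.sub hexp').congr_left fun s => ?_
  push_cast
  ring

/-- Pointwise convergence of the powers of two functions on the unit disc which agree to second
order at `0`, uniformly in `t ∈ [0, T]`. -/
lemma tendsto_pow_sub_pow_of_isLittleO {φ ψ : ℝ → ℂ} (hφ : ∀ s, ‖φ s‖ ≤ 1) (hψ : ∀ s, ‖ψ s‖ ≤ 1)
    (h : (fun s => φ s - ψ s) =o[nhds 0] fun s : ℝ => s ^ 2) (T x : ℝ) :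
    Tendsto (fun p : ℕ × ℝ => φ (Real.sqrt (p.2 / p.1) * x) ^ p.1
      - ψ (Real.sqrt (p.2 / p.1) * x) ^ p.1) (atTop ×ˢ 𝓟 (Set.Icc 0 T)) (nhds 0) := by
  have hn : Tendsto (fun p : ℕ × ℝ => p.1) (atTop ×ˢ 𝓟 (Set.Icc 0 T)) atTop := tendsto_fst
  have ht : ∀ᶠ p : ℕ × ℝ in atTop ×ˢ 𝓟 (Set.Icc 0 T), p.2 ∈ Set.Icc 0 T :=
    tendsto_snd.eventually (mem_principal_self (Set.Icc 0 T))
  have hs : Tendsto (fun p : ℕ × ℝ => Real.sqrt (p.2 / p.1) * x)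
      (atTop ×ˢ 𝓟 (Set.Icc 0 T)) (nhds 0) := by
    have hq : Tendsto (fun p : ℕ × ℝ => p.2 / p.1) (atTop ×ˢ 𝓟 (Set.Icc 0 T)) (nhds 0) := by
      refine squeeze_zero' ?_ ?_ ((tendsto_const_div_atTop_nhds_zero_nat T).comp hn)
      · filter_upwards [ht] with p hp
        exact div_nonneg hp.1 (Nat.cast_nonneg _)
      · filter_upwards [ht] with p hp
        exact div_le_div_of_nonneg_right hp.2 (Nat.cast_nonneg _)
    simpa using hq.sqrt.mul_const x
  have hbound : (fun p : ℕ × ℝ => φ (Real.sqrt (p.2 / p.1) * x) ^ p.1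
      - ψ (Real.sqrt (p.2 / p.1) * x) ^ p.1) =O[atTop ×ˢ 𝓟 (Set.Icc 0 T)]
      fun p => (p.1 : ℝ) * ‖φ (Real.sqrt (p.2 / p.1) * x) - ψ (Real.sqrt (p.2 / p.1) * x)‖ :=
    .of_norm_le fun p => norm_pow_sub_pow_le_of_norm_le_one (hφ _) (hψ _) _
  have hsmall := (Asymptotics.isBigO_refl (fun p : ℕ × ℝ => (p.1 : ℝ))
    (atTop ×ˢ 𝓟 (Set.Icc 0 T))).mul_isLittleO (h.comp_tendsto hs).norm_left
  refine (Asymptotics.isLittleO_one_iff ℝ).1 ((hbound.trans_isLittleO hsmall).trans_isBigO ?_)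
  refine .of_bound (T * x ^ 2) ?_
  filter_upwards [ht, hn.eventually_ge_atTop 1] with p hp hp1
  have hp0 : (0 : ℝ) < p.1 := by exact_mod_cast hp1
  have heq : (p.1 : ℝ) * (Real.sqrt (p.2 / p.1) * x) ^ 2 = p.2 * x ^ 2 := by
    rw [mul_pow, Real.sq_sqrt (div_nonneg hp.1 hp0.le)]
    field_simp
  simp only [Function.comp_apply, heq, norm_one, mul_one]
  rw [Real.norm_of_nonneg (mul_nonneg hp.1 (sq_nonneg x))]
  exact mul_le_mul_of_nonneg_right hp.2 (sq_nonneg x)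

/-- let `μ` be a Borel probability measure on `ℝ` with zero mean and finite
positive second moment `D`, and characteristic function `χ_μ`. Then for every `u ∈ Ĥ` and
`T > 0`, the operators of multiplication by `x ↦ χ_μ(√(t/n)·x)ⁿ` (the mean values of the
quantum random walks `E Û_n(t)`) applied to `u` converge, uniformly in `t ∈ [0,T]`, to the
multiplication by `x ↦ e^{−tDx²/2}` applied to `u` (strong operator convergence, uniform
on every segment). -/
theorem chernoff_convergence_of_mean_random_walk (μ : Measure ℝ) [IsProbabilityMeasure μ]
    (hmom : Integrable (fun x : ℝ => x ^ 2) μ) (hmean : (∫ x, x ∂μ) = 0)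
    (D : ℝ) (hD : D = ∫ x, x ^ 2 ∂μ) (hD0 : 0 < D)
    (u : Hhat) (T : ℝ) (hT : 0 < T) :
    ∀ ε > 0, ∃ N : ℕ, ∀ n ≥ N, ∀ t ∈ Set.Icc (0 : ℝ) T,
      ‖mulElem
          (fun x : ℝ =>
            (∫ y, Complex.exp ((Real.sqrt (t / n) * x * y : ℝ) * Complex.I) ∂μ) ^ n) u
        - mulElem (fun x : ℝ => ((Real.exp (-(t * D * x ^ 2) / 2) : ℝ) : ℂ)) u‖ < ε := by
  intro ε hε
  set ψ : ℝ → ℂ := fun s => (Real.exp (-(D * s ^ 2 / 2)) : ℝ) with hψdef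
  have hψ : ∀ s, ‖ψ s‖ ≤ 1 := fun s => by
    rw [hψdef, Complex.norm_real, Real.norm_of_nonneg (Real.exp_nonneg _)]
    exact Real.exp_le_one_iff.2 (neg_nonpos.2 (by positivity))
  have hφ : ∀ s, ‖charFun μ s‖ ≤ 1 := norm_charFun_le_one
  have hlittle : (fun s => charFun μ s - ψ s) =o[nhds 0] fun s : ℝ => s ^ 2 := by
    simpa only [hψdef, hD] using charFun_sub_exp_isLittleO hmom hmean
  have hpow : ∀ g : ℝ → ℂ, (∀ s, ‖g s‖ ≤ 1) → ∀ (n : ℕ) (s : ℝ), ‖g s ^ n‖ ≤ 1 :=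
    fun g hg n s => by
      rw [norm_pow]
      exact pow_le_one₀ (norm_nonneg _) (hg s)
  have key := tendsto_norm_mulElem_sub (C := 1) (F := atTop ×ˢ 𝓟 (Set.Icc 0 T))
    (f := fun (p : ℕ × ℝ) x => charFun μ (Real.sqrt (p.2 / p.1) * x) ^ p.1)
    (g := fun (p : ℕ × ℝ) x => ψ (Real.sqrt (p.2 / p.1) * x) ^ p.1)
    (Eventually.of_forall fun p x => hpow (charFun μ) hφ p.1 _)
    (Eventually.of_forall fun p x => hpow ψ hψ p.1 _)
    (fun x => tendsto_pow_sub_pow_of_isLittleO hφ hψ hlittle T x) u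
  obtain ⟨N, hN⟩ := eventually_atTop.1
    (eventually_prod_principal_iff.1 (key.eventually (gt_mem_nhds hε)))
  refine ⟨max N 1, fun n hn t ht => ?_⟩
  have hn0 : (0 : ℝ) < n := by exact_mod_cast (le_max_right N 1).trans hn
  have hleft : (fun x : ℝ =>
      (∫ y, Complex.exp ((Real.sqrt (t / n) * x * y : ℝ) * Complex.I) ∂μ) ^ n)
      = fun x => charFun μ (Real.sqrt (t / n) * x) ^ n := by
    funext x
    simp only [charFun_apply_real, Complex.ofReal_mul]
  have hright : (fun x : ℝ => ((Real.exp (-(t * D * x ^ 2) / 2) : ℝ) : ℂ))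
      = fun x => ψ (Real.sqrt (t / n) * x) ^ n := by
    funext x
    simp only [hψdef]
    rw [← Complex.ofReal_pow, ← Real.exp_nat_mul, mul_pow,
      Real.sq_sqrt (div_nonneg ht.1 hn0.le)]
    congr 2
    field_simp
  rw [hleft, hright]
  exact hN n ((le_max_left N 1).trans hn) t ht

end
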